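/- Let (U, τ) be a Curtis table for a based complex, let j ∈ U_i, and let z ∈ ker d_i be a cycle with leading index j. Then for every boundary b ∈ im d_{i−1}, the vector z + b is nonzero and its leading index is at least j; that is, z has the lowest leading index among all representatives of its homology class. -/

import Mathlib

/-- The leading index (an element of `WithBot (Fin m)`, which is `⊥` exactly for the zero
vector) of a vector of the based `𝔽₂`-vector space `Fin m → ZMod 2`, whose ordered basis is
the standard one. -/
def lead {m : ℕ} (v : Fin m → ZMod 2) : WithBot (Fin m) :=
  (Finset.univ.filter fun j => v j ≠ 0).max

/-- `LTset S` is the set of leading indices of the nonzero elements of the subspace `S`. -/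
def LTset {m : ℕ} (S : Submodule (ZMod 2) (Fin m → ZMod 2)) : Set (Fin m) :=
  {j | ∃ v ∈ S, v ≠ 0 ∧ lead v = (j : WithBot (Fin m))}

/-- A based complex `X_0 → X_1 → ⋯ → X_N` of finite-dimensional `𝔽₂`-vector spaces with
ordered bases: `X_i` is modelled as `Fin (n i) → ZMod 2` via its ordered basis, and the
complex is extended by zero spaces in degrees `> N` (so `d_N = 0` holds automatically). -/
structure BasedComplex where
  N : ℕ
  n : ℕ → ℕ
  n_eq_zero : ∀ i, N < i → n i = 0
  d : ∀ i : ℕ, (Fin (n i) → ZMod 2) →ₗ[ZMod 2] (Fin (n (i + 1)) → ZMod 2)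
  d_comp : ∀ i, (d (i + 1)).comp (d i) = 0

namespace BasedComplex

/-- The cycles `ker d_i`. -/
def cyc (C : BasedComplex) (i : ℕ) : Submodule (ZMod 2) (Fin (C.n i) → ZMod 2) :=
  LinearMap.ker (C.d i)

/-- The boundaries `im d_{i-1}`, with the convention `d_{-1} = 0`. -/
def bdry (C : BasedComplex) : ∀ i : ℕ, Submodule (ZMod 2) (Fin (C.n i) → ZMod 2)
  | 0 => ⊥
  | (i + 1) => LinearMap.range (C.d i)

theorem bdry_zero (C : BasedComplex) : C.bdry 0 = ⊥ := rfl

theorem bdry_succ (C : BasedComplex) (i : ℕ) :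
    C.bdry (i + 1) = LinearMap.range (C.d i) := rfl

/-- The boundaries, viewed as a submodule of the cycles. -/
def bdryIn (C : BasedComplex) (i : ℕ) : Submodule (ZMod 2) (C.cyc i) :=
  (C.bdry i).comap (C.cyc i).subtype

/-- The homology `H_i = ker d_i / im d_{i-1}`. -/
abbrev homology (C : BasedComplex) (i : ℕ) :=
  C.cyc i ⧸ C.bdryIn i

end BasedComplex

/-- Given tag data `t`, where `t i k = some j` means that the basis index `k` of `X_i` is
tagged with target the basis index `j` of `X_{i+1}` (i.e. `τ_{i+1}(k) = j`),
`tagImage C t i` is the image of the partial function `τ_i` (which is empty for `i = 0`). -/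
def tagImage (C : BasedComplex) (t : ∀ i, Fin (C.n i) → Option (Fin (C.n (i + 1)))) :
    ∀ i : ℕ, Set (Fin (C.n i))
  | 0 => ∅
  | (i + 1) => {j | ∃ k, t i k = some j}

/-- A Curtis table for a based complex.  Here `t i` encodes the injective partial function
`τ_{i+1}` from the basis indices of `X_i` to the basis indices of `X_{i+1}`
(`t i k = some j` means `τ_{i+1}(k) = j`; the partial function `τ_0` is empty by
convention, and `τ_{N+1}` is automatically empty since `X_{N+1} = 0`). -/
structure CurtisTable (C : BasedComplex) where
  /-- the untagged items in each degree -/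
  U : ∀ i, Set (Fin (C.n i))
  /-- the tags -/
  t : ∀ i, Fin (C.n i) → Option (Fin (C.n (i + 1)))
  /-- the tags form an injective partial function -/
  t_inj : ∀ i k k' j, t i k = some j → t i k' = some j → k = k'
  /-- (i): `U_i` and the image of `τ_i` are disjoint … -/
  disj : ∀ i, Disjoint (U i) (tagImage C t i)
  /-- (i): … and their union is `LT(ker d_i)` -/
  union_eq : ∀ i, U i ∪ tagImage C t i = LTset (C.cyc i)
  /-- (ii): no index is both untagged and in the domain of `τ_{i+1}` -/
  mem_U_not_dom : ∀ i j, j ∈ U i → t i j = none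
  /-- (ii): no index is both in the image of `τ_i` and in the domain of `τ_{i+1}` -/
  mem_tagImage_not_dom : ∀ i j, j ∈ tagImage C t i → t i j = none
  /-- (ii): every basis index is untagged, or in the image of `τ_i`, or in the domain of
  `τ_{i+1}` -/
  cover : ∀ i j, j ∈ U i ∨ j ∈ tagImage C t i ∨ (t i j).isSome
  /-- (iii): if `τ_{i+1}(k) = j` then there is an `x` with leading index `k` such that
  `d_i x ≠ 0` and `d_i x` has leading index `j` -/
  tag_spec : ∀ i k j, t i k = some j →
    ∃ x : Fin (C.n i) → ZMod 2, lead x = (k : WithBot (Fin (C.n i))) ∧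
      C.d i x ≠ 0 ∧ lead (C.d i x) = (j : WithBot (Fin (C.n (i + 1))))

theorem lead_eq_coe_iff {m : ℕ} {v : Fin m → ZMod 2} {j : Fin m} :
    lead v = (j : WithBot (Fin m)) ↔ v j ≠ 0 ∧ ∀ k, j < k → v k = 0 := by
  constructor
  · intro h
    refine ⟨(Finset.mem_filter.1 (Finset.mem_of_max h)).2, fun k hk => ?_⟩
    by_contra hv
    exact absurd (Finset.le_max_of_eq (Finset.mem_filter.2 ⟨Finset.mem_univ k, hv⟩) h)
      (not_le.2 hk)
  · rintro ⟨hj, h⟩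
    refine le_antisymm (Finset.max_le fun k hk => ?_)
      (Finset.le_max (Finset.mem_filter.2 ⟨Finset.mem_univ j, hj⟩))
    refine WithBot.coe_le_coe.2 (le_of_not_gt fun hlt => ?_)
    exact (Finset.mem_filter.1 hk).2 (h k hlt)

theorem lead_eq_bot_iff {m : ℕ} {v : Fin m → ZMod 2} : lead v = ⊥ ↔ v = 0 := by
  rw [lead, Finset.max_eq_bot, Finset.filter_eq_empty_iff, funext_iff]
  simp

theorem apply_eq_zero_of_lead_lt {m : ℕ} {v : Fin m → ZMod 2} {k : Fin m}
    (h : lead v < (k : WithBot (Fin m))) : v k = 0 := by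
  by_contra hv
  exact absurd (Finset.le_max (Finset.mem_filter.2 ⟨Finset.mem_univ k, hv⟩)) (not_le.2 h)

/-- Adding a vector of lower leading index does not change the leading index. -/
theorem lead_add_eq_of_lt {m : ℕ} {v w : Fin m → ZMod 2} {j : Fin m}
    (hv : lead v = (j : WithBot (Fin m))) (hw : lead w < (j : WithBot (Fin m))) :
    lead (v + w) = (j : WithBot (Fin m)) := by
  obtain ⟨hj, h⟩ := lead_eq_coe_iff.1 hv
  refine lead_eq_coe_iff.2 ⟨?_, fun k hk => ?_⟩
  · simpa [apply_eq_zero_of_lead_lt hw] using hj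
  · simp [h k hk, apply_eq_zero_of_lead_lt (hw.trans (WithBot.coe_lt_coe.2 hk))]

/-- Two vectors over `ZMod 2` with the same leading index have a sum of lower leading index. -/
theorem lead_add_lt {m : ℕ} {v w : Fin m → ZMod 2} {j : Fin m}
    (hv : lead v = (j : WithBot (Fin m))) (hw : lead w = (j : WithBot (Fin m))) :
    lead (v + w) < (j : WithBot (Fin m)) := by
  obtain ⟨hvj, hv⟩ := lead_eq_coe_iff.1 hv
  obtain ⟨hwj, hw⟩ := lead_eq_coe_iff.1 hw
  have two : ∀ a b : ZMod 2, a ≠ 0 → b ≠ 0 → a + b = 0 := by decide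
  unfold lead Finset.max
  refine (Finset.sup_lt_iff (WithBot.bot_lt_coe j)).2 fun k hk => WithBot.coe_lt_coe.2 ?_
  by_contra hjk
  refine (Finset.mem_filter.1 hk).2 ?_
  rcases (not_lt.1 hjk).eq_or_lt with rfl | hlt
  · exact two _ _ hvj hwj
  · simp [hv k hlt, hw k hlt]

theorem eq_top_of_LTset_eq_univ {m : ℕ} {S : Submodule (ZMod 2) (Fin m → ZMod 2)}
    (hS : LTset S = Set.univ) : S = ⊤ := by
  have key : ∀ (a : WithBot (Fin m)) (v : Fin m → ZMod 2), lead v = a → v ∈ S := by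
    intro a
    induction a using WellFoundedLT.induction with
    | ind a ih =>
      intro v hv
      induction a using WithBot.recBotCoe with
      | bot => rw [lead_eq_bot_iff.1 hv]; exact S.zero_mem
      | coe j =>
        obtain ⟨w, hwS, -, hw⟩ : j ∈ LTset S := hS ▸ Set.mem_univ j
        exact (S.add_mem_iff_left hwS).1 (ih _ (lead_add_lt hv hw) _ rfl)
  exact eq_top_iff.2 fun v _ => key _ v rfl

/-- The leading index of a nonzero combination of vectors with distinct leading indices is
the leading index of one of them. -/
theorem exists_lead_eq_of_mem_span_range {m : ℕ} {ι : Type*} [Finite ι]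
    {w : ι → Fin m → ZMod 2} {l : ι → Fin m} (hl : Function.Injective l)
    (hw : ∀ k, lead (w k) = (l k : WithBot (Fin m))) {v : Fin m → ZMod 2}
    (hv : v ∈ Submodule.span (ZMod 2) (Set.range w)) (hv0 : v ≠ 0) :
    ∃ k, lead v = (l k : WithBot (Fin m)) := by
  classical
  cases nonempty_fintype ι
  obtain ⟨c, rfl⟩ := (Submodule.mem_span_range_iff_exists_fun (ZMod 2)).1 hv
  have hne : (Finset.univ.filter fun k => c k ≠ 0).Nonempty := by
    by_contra h
    rw [Finset.not_nonempty_iff_eq_empty, Finset.filter_eq_empty_iff] at h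
    exact hv0 (Finset.sum_eq_zero fun k hk => by rw [not_not.1 (h hk), zero_smul])
  obtain ⟨k, hk, hmax⟩ := Finset.exists_max_image _ l hne
  have hck : c k ≠ 0 := (Finset.mem_filter.1 hk).2
  have hle : ∀ k', c k' ≠ 0 → l k' ≤ l k := fun k' h =>
    hmax k' (Finset.mem_filter.2 ⟨Finset.mem_univ _, h⟩)
  refine ⟨k, lead_eq_coe_iff.2 ⟨?_, fun q hq => ?_⟩⟩
  · rw [Finset.sum_apply, Finset.sum_eq_single k]
    · exact mul_ne_zero hck (lead_eq_coe_iff.1 (hw k)).1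
    · intro k' _ hne'
      by_cases h : c k' = 0
      · simp [h]
      · simp [(lead_eq_coe_iff.1 (hw k')).2 (l k)
          (lt_of_le_of_ne (hle k' h) fun e => hne' (hl e))]
    · simp
  · rw [Finset.sum_apply]
    refine Finset.sum_eq_zero fun k' _ => ?_
    by_cases h : c k' = 0
    · simp [h]
    · simp [(lead_eq_coe_iff.1 (hw k')).2 q ((hle k' h).trans_lt hq)]

/-- In a Curtis table, every leading index of a boundary is the target of a tag. -/
theorem CurtisTable.LTset_bdry_subset {C : BasedComplex} (T : CurtisTable C) (i : ℕ) :
    LTset (C.bdry i) ⊆ tagImage C T.t i := by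
  rintro j ⟨b, hb, hb0, hbj⟩
  cases i with
  | zero => exact absurd ((Submodule.mem_bot _).1 hb) hb0
  | succ i =>
    obtain ⟨y, rfl⟩ := hb
    let ι := {k : Fin (C.n i) // (T.t i k).isSome}
    let l : ι → Fin (C.n (i + 1)) := fun k => (T.t i k).get k.2
    have ht : ∀ k : ι, T.t i k = some (l k) := fun k => (Option.some_get k.2).symm
    have hl : Function.Injective l := fun k k' h =>
      Subtype.ext (T.t_inj i k k' (l k) (ht k) (h ▸ ht k'))
    choose x hxk hx0 hxl using fun k : ι => T.tag_spec i k (l k) (ht k)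
    have htop : C.cyc i ⊔ Submodule.span (ZMod 2) (Set.range x) = ⊤ := by
      refine eq_top_of_LTset_eq_univ (Set.eq_univ_of_forall fun k => ?_)
      by_cases hk : (T.t i k).isSome
      · refine ⟨x ⟨k, hk⟩, Submodule.mem_sup_right (Submodule.subset_span ⟨_, rfl⟩), ?_,
          hxk ⟨k, hk⟩⟩
        intro h
        exact hx0 ⟨k, hk⟩ (by rw [h, map_zero])
      · have hmem : k ∈ LTset (C.cyc i) := by
          rw [← T.union_eq i]
          rcases T.cover i k with h | h | h
          exacts [Or.inl h, Or.inr h, absurd h hk]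
        obtain ⟨v, hv, hv0, hvk⟩ := hmem
        exact ⟨v, Submodule.mem_sup_left hv, hv0, hvk⟩
    obtain ⟨u, hu, s, hs, rfl⟩ := Submodule.mem_sup.1 (htop ▸ Submodule.mem_top (x := y))
    have hus : C.d i (u + s) = C.d i s := by
      rw [map_add, LinearMap.mem_ker.1 hu, zero_add]
    have hspan : C.d i (u + s) ∈ Submodule.span (ZMod 2) (Set.range fun k => C.d i (x k)) := by
      rw [hus, Set.range_comp' (C.d i) x, Submodule.span_image]
      exact Submodule.mem_map_of_mem hs
    obtain ⟨k, hk⟩ := exists_lead_eq_of_mem_span_range hl hxl hspan hb0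
    exact ⟨k, (ht k).trans (congrArg some (WithBot.coe_injective (hk.symm.trans hbj)))⟩

/-- If `j ∈ U_i` and `z ∈ ker d_i` is a cycle with leading index `j`, then for every
boundary `b ∈ im d_{i-1}` the vector `z + b` is nonzero with leading index at least `j`:
`z` has the lowest leading index among all representatives of its homology class. -/
theorem untagged_cycle_minimal (C : BasedComplex) (T : CurtisTable C) (i : ℕ)
    (j : Fin (C.n i)) (hj : j ∈ T.U i)
    (z : Fin (C.n i) → ZMod 2) (hz : z ∈ C.cyc i)
    (hlz : lead z = (j : WithBot (Fin (C.n i))))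
    (b : Fin (C.n i) → ZMod 2) (hb : b ∈ C.bdry i) :
    z + b ≠ 0 ∧ (j : WithBot (Fin (C.n i))) ≤ lead (z + b) := by
  have hle : (j : WithBot (Fin (C.n i))) ≤ lead (z + b) := by
    by_contra h
    have hzb : lead (z + (z + b)) = (j : WithBot (Fin (C.n i))) :=
      lead_add_eq_of_lt hlz (not_le.1 h)
    have hzz : z + z = 0 := funext fun k => CharTwo.add_self_eq_zero (z k)
    rw [← add_assoc, hzz, zero_add] at hzb
    have hb0 : b ≠ 0 := fun h0 => by
      rw [lead_eq_bot_iff.2 h0] at hzb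
      exact WithBot.bot_ne_coe hzb
    exact Set.disjoint_left.1 (T.disj i) hj (T.LTset_bdry_subset i ⟨b, hb, hb0, hzb⟩)
  refine ⟨fun h0 => ?_, hle⟩
  rw [lead_eq_bot_iff.2 h0] at hle
  exact WithBot.not_coe_le_bot j hle
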